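/- Assume |ξ| = 1/(2βη²γ). Then the restriction of Â(ξ) to E(ξ) has exactly two eigenvalues, namely λ₀ = −1/(βη²γ²) and λ₁ = −1/(2βη²γ²); the eigenspace of λ₁ is {(e, −(i/(γλ₁)) ξ × e) : e ∈ ℂ³, ξ · e = 0}, which is two-dimensional; and the restriction of Â(ξ) to E(ξ) is not diagonalizable, i.e. E(ξ) has no basis consisting of eigenvectors of Â(ξ). -/

import Mathlib

noncomputable section

open Complex

/-- ℂ³ with the Hermitian (Euclidean) norm. -/
abbrev V3 : Type := EuclideanSpace ℂ (Fin 3)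
/-- ℝ³ with the Euclidean norm. -/
abbrev R3 : Type := EuclideanSpace ℝ (Fin 3)

/-- The cross product, extended ℂ-bilinearly to ℂ³. -/
def cross (a b : V3) : V3 :=
  (WithLp.equiv 2 (Fin 3 → ℂ)).symm
    ![a 1 * b 2 - a 2 * b 1, a 2 * b 0 - a 0 * b 2, a 0 * b 1 - a 1 * b 0]

/-- The dot product, extended ℂ-bilinearly to ℂ³. -/
def dotc (a b : V3) : ℂ := a 0 * b 0 + a 1 * b 1 + a 2 * b 2

/-- The coercion of a real vector to a complex vector. -/
def toC (ξ : R3) : V3 := (WithLp.equiv 2 (Fin 3 → ℂ)).symm fun j => ((ξ j : ℝ) : ℂ)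

/-- The Fourier-side Maxwell operator Â(ξ). -/
def Ahat (β η γ : ℝ) (ξ : R3) (v : V3 × V3) : V3 × V3 :=
  (-(1 / ((β : ℂ) * (η : ℂ) ^ 2 * (γ : ℂ) ^ 2)) • v.1 + (I / (γ : ℂ)) • cross (toC ξ) v.2,
   (-(I / (γ : ℂ))) • cross (toC ξ) v.1)

/-- The eigenvalue λ₀ = −1/(βη²γ²). -/
def lam0 (β η γ : ℝ) : ℂ := -(1 / ((β : ℂ) * (η : ℂ) ^ 2 * (γ : ℂ) ^ 2))

/-- The eigenvalue λ₁ = −1/(2βη²γ²). -/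
def lam1 (β η γ : ℝ) : ℂ := -(1 / (2 * (β : ℂ) * (η : ℂ) ^ 2 * (γ : ℂ) ^ 2))

lemma cross_add (X u v : V3) : cross X (u + v) = cross X u + cross X v := by
  ext i; fin_cases i <;> simp [cross] <;> ring

lemma cross_smul (X : V3) (c : ℂ) (v : V3) : cross X (c • v) = c • cross X v := by
  ext i; fin_cases i <;> simp [cross] <;> ring

lemma cross_zero (X : V3) : cross X 0 = 0 := by
  simpa using cross_smul X 0 0

lemma cross_self_eq_zero (X : V3) : cross X X = 0 := by
  ext i; fin_cases i <;> simp [cross] <;> ring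

lemma cross_cross_self (X v : V3) :
    cross X (cross X v) = dotc X v • X - dotc X X • v := by
  ext i; fin_cases i <;> simp [cross, dotc] <;> ring

lemma dotc_cross_self (X v : V3) : dotc X (cross X v) = 0 := by
  simp [cross, dotc]; ring

lemma dotc_add (X u v : V3) : dotc X (u + v) = dotc X u + dotc X v := by
  simp [dotc]; ring

lemma dotc_smul (X : V3) (c : ℂ) (v : V3) : dotc X (c • v) = c * dotc X v := by
  simp [dotc]; ring

lemma dotc_zero (X : V3) : dotc X 0 = 0 := by
  simp [dotc]

lemma dotc_toC_self (ξ : R3) : dotc (toC ξ) (toC ξ) = (‖ξ‖ : ℂ) ^ 2 := by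
  have h := EuclideanSpace.real_norm_sq_eq ξ
  rw [Fin.sum_univ_three] at h
  rw [← ofReal_pow, h]
  simp [dotc, toC]; ring

/-- The plane orthogonal to a nonzero vector for the bilinear dot product is two-dimensional. -/
lemma exists_basis_dotc_eq_zero {X : V3} (hX : X ≠ 0) :
    ∃ u w : V3, dotc X u = 0 ∧ dotc X w = 0 ∧ LinearIndependent ℂ ![u, w] ∧
      ∀ e : V3, dotc X e = 0 → ∃ c d : ℂ, e = c • u + d • w := by
  have hX' : X 0 ≠ 0 ∨ X 1 ≠ 0 ∨ X 2 ≠ 0 := by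
    by_contra! hc
    exact hX (by ext i; fin_cases i <;> simp [hc])
  rcases hX' with h0 | h0 | h0
  · refine ⟨!₂[-X 1, X 0, 0], !₂[-X 2, 0, X 0], by simp [dotc]; ring, by simp [dotc]; ring,
      LinearIndependent.pair_iff.2 fun s t hst => ?_, fun e he => ⟨e 1 / X 0, e 2 / X 0, ?_⟩⟩
    · have h1 := congrArg (fun v : V3 => v 1) hst
      have h2 := congrArg (fun v : V3 => v 2) hst
      simpa [h0] using And.intro h1 h2
    · rw [dotc] at he
      ext i; fin_cases i <;> simp <;> field_simp
      linear_combination he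
  · refine ⟨!₂[X 1, -X 0, 0], !₂[0, -X 2, X 1], by simp [dotc]; ring, by simp [dotc]; ring,
      LinearIndependent.pair_iff.2 fun s t hst => ?_, fun e he => ⟨e 0 / X 1, e 2 / X 1, ?_⟩⟩
    · have h1 := congrArg (fun v : V3 => v 0) hst
      have h2 := congrArg (fun v : V3 => v 2) hst
      simpa [h0] using And.intro h1 h2
    · rw [dotc] at he
      ext i; fin_cases i <;> simp <;> field_simp
      linear_combination he
  · refine ⟨!₂[X 2, 0, -X 0], !₂[0, X 2, -X 1], by simp [dotc]; ring, by simp [dotc]; ring,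
      LinearIndependent.pair_iff.2 fun s t hst => ?_, fun e he => ⟨e 0 / X 2, e 1 / X 2, ?_⟩⟩
    · have h1 := congrArg (fun v : V3 => v 0) hst
      have h2 := congrArg (fun v : V3 => v 1) hst
      simpa [h0] using And.intro h1 h2
    · rw [dotc] at he
      ext i; fin_cases i <;> simp <;> field_simp
      linear_combination he

/-- The Maxwell operator with damping coefficient `2 * μ` and coupling `a`. -/
def maxwell (a μ : ℂ) (X : V3) : V3 × V3 →ₗ[ℂ] V3 × V3 where
  toFun v := ((2 * μ) • v.1 + a • cross X v.2, (-a) • cross X v.1)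
  map_add' u v := by
    ext1
    · simp only [Prod.fst_add, Prod.snd_add, cross_add]; module
    · simp only [Prod.fst_add, Prod.snd_add, cross_add]; module
  map_smul' c v := by
    ext1
    · simp only [Prod.smul_fst, Prod.smul_snd, cross_smul, RingHom.id_apply]; module
    · simp only [Prod.smul_fst, Prod.smul_snd, cross_smul, RingHom.id_apply]; module

lemma maxwell_apply (a μ : ℂ) (X e b : V3) :
    maxwell a μ X (e, b) = ((2 * μ) • e + a • cross X b, (-a) • cross X e) := rfl

lemma Ahat_eq_maxwell (β η γ : ℝ) (ξ : R3) (v : V3 × V3) :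
    Ahat β η γ ξ v = maxwell (I / γ) (lam1 β η γ) (toC ξ) v := by
  have h : 2 * lam1 β η γ = -(1 / ((β : ℂ) * (η : ℂ) ^ 2 * (γ : ℂ) ^ 2)) := by
    rw [lam1]; ring
  rw [← Prod.mk.eta (p := v), maxwell_apply, h]
  rfl

section Critical

variable {a μ : ℂ} {X : V3}

lemma maxwell_eq_smul_iff (hμ : μ ≠ 0) (hq : a ^ 2 * dotc X X = -μ ^ 2) (e b : V3) :
    maxwell a μ X (e, b) = μ • (e, b) ↔
      dotc X e = 0 ∧ b = (-(a / μ)) • cross X e := by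
  rw [maxwell_apply, Prod.smul_mk, Prod.mk.injEq]
  constructor
  · rintro ⟨h1, h2⟩
    constructor
    · have h3 := congrArg (dotc X) h1
      simp only [dotc_add, dotc_smul, dotc_cross_self] at h3
      have h4 : μ * dotc X e = 0 := by linear_combination h3
      exact (mul_eq_zero.1 h4).resolve_left hμ
    · calc b = μ⁻¹ • (μ • b) := by rw [inv_smul_smul₀ hμ]
        _ = _ := by rw [← h2, smul_smul]; congr 1; ring
  · rintro ⟨h1, rfl⟩
    constructor
    · rw [cross_smul, cross_cross_self, h1, zero_smul, zero_sub, smul_neg, smul_neg, smul_smul,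
        smul_smul, ← neg_smul, ← add_smul]
      congr 1
      field_simp
      linear_combination hq
    · rw [smul_smul]
      congr 1
      field_simp

lemma eq_of_maxwell_eq_smul (hμ : μ ≠ 0) (hq : a ^ 2 * dotc X X = -μ ^ 2) {l : ℂ}
    {v : V3 × V3} (hb : dotc X v.2 = 0) (hv : v ≠ 0) (h : maxwell a μ X v = l • v) :
    l = 2 * μ ∨ l = μ := by
  obtain ⟨e, b⟩ := v
  rw [maxwell_apply, Prod.smul_mk, Prod.mk.injEq] at h
  obtain ⟨h1, h2⟩ := h
  simp only at hb
  have hXX : dotc X X ≠ 0 := fun h0 => by simp [h0, hμ] at hq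
  have ha : a ≠ 0 := fun h0 => by simp [h0, hμ] at hq
  by_contra! hl
  have hdot : dotc X e = 0 := by
    have h3 := congrArg (dotc X) h1
    simp only [dotc_add, dotc_smul, dotc_cross_self] at h3
    have h4 : (2 * μ - l) * dotc X e = 0 := by linear_combination h3
    exact (mul_eq_zero.1 h4).resolve_left (sub_ne_zero.2 hl.1.symm)
  have hcross : ∀ w : V3, dotc X w = 0 → cross X w = 0 → w = 0 := fun w hw hw' => by
    have h3 := cross_cross_self X w
    rw [hw', cross_zero, hw, zero_smul, zero_sub, eq_comm, neg_eq_zero] at h3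
    exact (smul_eq_zero.1 h3).resolve_left hXX
  have he : e = 0 := by
    have h3 : (l - μ) ^ 2 • e = 0 := by
      have h4 := congrArg (fun w => a • cross X w) h2
      simp only [cross_smul, cross_cross_self, hdot] at h4
      have h5 : (l - μ) ^ 2 • e = l ^ 2 • e - (2 * μ * l) • e - (a ^ 2 * dotc X X) • e := by
        rw [hq]; module
      linear_combination (norm := module) h5 - l • h1 - h4
    exact (smul_eq_zero.1 h3).resolve_left (pow_ne_zero 2 (sub_ne_zero.2 hl.2))
  subst he
  have hb0 : cross X b = 0 := by
    simpa [ha] using h1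
  exact hv (by rw [hcross b hb hb0]; rfl)

lemma exists_basis_maxwell_eigenspace (hμ : μ ≠ 0) (hq : a ^ 2 * dotc X X = -μ ^ 2)
    (hX : X ≠ 0) :
    ∃ v₁ v₂ : V3 × V3,
      dotc X v₁.2 = 0 ∧ maxwell a μ X v₁ = μ • v₁ ∧
      dotc X v₂.2 = 0 ∧ maxwell a μ X v₂ = μ • v₂ ∧
      LinearIndependent ℂ ![v₁, v₂] ∧
      ∀ v : V3 × V3, dotc X v.2 = 0 → maxwell a μ X v = μ • v →
        ∃ c₁ c₂ : ℂ, v = c₁ • v₁ + c₂ • v₂ := by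
  obtain ⟨u, w, hu, hw, hlin, hspan⟩ := exists_basis_dotc_eq_zero hX
  refine ⟨(u, (-(a / μ)) • cross X u), (w, (-(a / μ)) • cross X w),
    by rw [dotc_smul, dotc_cross_self, mul_zero], (maxwell_eq_smul_iff hμ hq _ _).2 ⟨hu, rfl⟩,
    by rw [dotc_smul, dotc_cross_self, mul_zero], (maxwell_eq_smul_iff hμ hq _ _).2 ⟨hw, rfl⟩,
    LinearIndependent.pair_iff.2 fun s t hst =>
      LinearIndependent.pair_iff.1 hlin s t (congrArg Prod.fst hst), ?_⟩
  rintro ⟨e, b⟩ - hv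
  obtain ⟨he, rfl⟩ := (maxwell_eq_smul_iff hμ hq e b).1 hv
  obtain ⟨c, d, rfl⟩ := hspan e he
  refine ⟨c, d, Prod.ext rfl ?_⟩
  simp only [Prod.snd_add, Prod.smul_snd, cross_add, cross_smul]
  module

/-- The eigenvectors of the Maxwell operator do not span the divergence-free subspace. -/
lemma not_exists_maxwell_eigenvectors_span {ι : Type*} [Fintype ι] (hμ : μ ≠ 0)
    (hq : a ^ 2 * dotc X X = -μ ^ 2) (hX : X ≠ 0) (f : ι → V3 × V3)
    (hf : ∀ i, dotc X (f i).2 = 0 ∧ f i ≠ 0 ∧ ∃ l : ℂ, maxwell a μ X (f i) = l • f i) :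
    ¬ ∀ v : V3 × V3, dotc X v.2 = 0 → ∃ c : ι → ℂ, v = ∑ i, c i • f i := by
  intro hspan
  let T := maxwell a μ X
  let P : V3 × V3 →ₗ[ℂ] V3 × V3 :=
    (T - (2 * μ) • LinearMap.id) ∘ₗ (T - μ • LinearMap.id)
  have hP : ∀ i, P (f i) = 0 := fun i => by
    obtain ⟨hb, hne, l, hl⟩ := hf i
    have hl' : T (f i) = l • f i := hl
    have h1 : P (f i) = ((l - 2 * μ) * (l - μ)) • f i := by
      simp only [P, LinearMap.comp_apply, LinearMap.sub_apply, LinearMap.smul_apply,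
        LinearMap.id_apply, map_sub, map_smul, hl']
      module
    rcases eq_of_maxwell_eq_smul hμ hq hb hne hl with rfl | rfl <;> simp [h1]
  obtain ⟨u, w, hu, -, hlin, -⟩ := exists_basis_dotc_eq_zero hX
  have hu0 : u ≠ 0 := hlin.ne_zero 0
  obtain ⟨c, hc⟩ := hspan (u, 0) (dotc_zero X)
  have h0 : P (u, 0) = 0 := by
    rw [hc, map_sum]
    exact Finset.sum_eq_zero fun i _ => by rw [map_smul, hP, smul_zero]
  have h1 : (P (u, 0)).1 = (a ^ 2 * dotc X X) • u := by
    simp only [P, T, LinearMap.comp_apply, LinearMap.sub_apply, LinearMap.smul_apply,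
      LinearMap.id_apply, map_sub, map_smul, maxwell_apply, cross_zero, cross_add, cross_smul,
      cross_cross_self, hu, Prod.fst_sub, Prod.smul_fst]
    module
  rw [h0, hq, Prod.fst_zero, eq_comm, smul_eq_zero] at h1
  simp [hμ, hu0] at h1

end Critical

/-- if |ξ| = 1/(2βη²γ), the restriction of Â(ξ) to E(ξ) has exactly the two
eigenvalues λ₀ = −1/(βη²γ²) and λ₁ = −1/(2βη²γ²); the eigenspace of λ₁ is
{(e, −(i/(γλ₁)) ξ × e) : ξ·e = 0}, which is two-dimensional; and the restriction of Â(ξ) to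
E(ξ) is not diagonalizable: E(ξ) (which is five-dimensional) has no basis of eigenvectors. -/
theorem Ahat_not_diagonalizable (β η γ : ℝ) (hβ : 0 < β) (hη : 0 < η) (hγ : 0 < γ)
    (ξ : R3) (hξ : ξ ≠ 0) (h : ‖ξ‖ = 1 / (2 * β * η ^ 2 * γ)) :
    (∀ lam : ℂ,
      (∃ v : V3 × V3, dotc (toC ξ) v.2 = 0 ∧ v ≠ 0 ∧ Ahat β η γ ξ v = lam • v) ↔
        lam = lam0 β η γ ∨ lam = lam1 β η γ) ∧
    (∀ e b : V3, dotc (toC ξ) b = 0 →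
      (Ahat β η γ ξ (e, b) = lam1 β η γ • (e, b) ↔
        dotc (toC ξ) e = 0 ∧ b = (-(I / ((γ : ℂ) * lam1 β η γ))) • cross (toC ξ) e)) ∧
    (∃ v₁ v₂ : V3 × V3,
      dotc (toC ξ) v₁.2 = 0 ∧ Ahat β η γ ξ v₁ = lam1 β η γ • v₁ ∧
      dotc (toC ξ) v₂.2 = 0 ∧ Ahat β η γ ξ v₂ = lam1 β η γ • v₂ ∧
      LinearIndependent ℂ ![v₁, v₂] ∧
      ∀ v : V3 × V3, dotc (toC ξ) v.2 = 0 → Ahat β η γ ξ v = lam1 β η γ • v →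
        ∃ c₁ c₂ : ℂ, v = c₁ • v₁ + c₂ • v₂) ∧
    ¬ ∃ f : Fin 5 → V3 × V3,
        (∀ i, dotc (toC ξ) (f i).2 = 0 ∧ f i ≠ 0 ∧ ∃ μ : ℂ, Ahat β η γ ξ (f i) = μ • f i) ∧
        LinearIndependent ℂ f ∧
        (∀ v : V3 × V3, dotc (toC ξ) v.2 = 0 → ∃ c : Fin 5 → ℂ, v = ∑ i, c i • f i) := by
  have hβ' : (β : ℂ) ≠ 0 := ofReal_ne_zero.2 hβ.ne'
  have hη' : (η : ℂ) ≠ 0 := ofReal_ne_zero.2 hη.ne'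
  have hγ' : (γ : ℂ) ≠ 0 := ofReal_ne_zero.2 hγ.ne'
  have hμ : lam1 β η γ ≠ 0 := by
    rw [lam1]
    exact neg_ne_zero.2 (one_div_ne_zero (by simp [hβ', hη', hγ']))
  have h0 : lam0 β η γ = 2 * lam1 β η γ := by rw [lam0, lam1]; ring
  have hq : (I / (γ : ℂ)) ^ 2 * dotc (toC ξ) (toC ξ) = -lam1 β η γ ^ 2 := by
    rw [dotc_toC_self, h, lam1]
    push_cast
    rw [div_pow, I_sq]
    field_simp
  have hX : toC ξ ≠ 0 := fun hX => by
    apply hξ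
    ext i
    simpa [toC] using congrArg (fun v : V3 => v i) hX
  simp only [Ahat_eq_maxwell, h0, ← div_div]
  refine ⟨fun l => ⟨?_, ?_⟩, fun e b _ => maxwell_eq_smul_iff hμ hq e b,
    exists_basis_maxwell_eigenspace hμ hq hX, ?_⟩
  · rintro ⟨v, hb, hv, hl⟩
    exact eq_of_maxwell_eq_smul hμ hq hb hv hl
  · rintro (rfl | rfl)
    · refine ⟨(toC ξ, 0), dotc_zero _, fun hv => hX (congrArg Prod.fst hv), ?_⟩
      rw [maxwell_apply, cross_zero, cross_self_eq_zero, smul_zero, smul_zero, add_zero,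
        Prod.smul_mk, smul_zero]
    · obtain ⟨v, _, hb, hv, _, _, hlin, _⟩ := exists_basis_maxwell_eigenspace hμ hq hX
      exact ⟨v, hb, hlin.ne_zero 0, hv⟩
  · rintro ⟨f, hf, -, hspan⟩
    exact not_exists_maxwell_eigenvectors_span hμ hq hX f hf hspan
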